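/- Let m be a cube-free integer, m ≠ 0, ±1, and write m = hk² with h, k coprime squarefree integers. If m ≢ ±1 (mod 9), then the discriminant of the pure cubic field ℚ(∛m) is −27(hk)²; if m ≡ ±1 (mod 9), the discriminant is −3(hk)². -/

import Mathlib

lemma pcf_cubefree (h k : ℤ) (hh : Squarefree h) (hk : Squarefree k) (hc : IsCoprime h k)
    (p : ℤ) (hp : Prime p) : ¬ (p ^ 3 ∣ h * k ^ 2) := by
  intro hd
  by_cases hpk : p ∣ k
  · have hph : ¬ p ∣ h := fun hph => hp.not_isUnit (hc.isUnit_of_dvd' hph hpk)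
    have h1 : IsCoprime (p ^ 3) h := ((Prime.coprime_iff_not_dvd hp).2 hph).pow_left
    have h2 : p ^ 3 ∣ k ^ 2 := h1.dvd_of_dvd_mul_left hd
    obtain ⟨k', rfl⟩ := hpk
    have h3 : p ∣ k' ^ 2 := by
      have : p ^ 2 * p ∣ p ^ 2 * k' ^ 2 := by convert h2 using 1 <;> ring
      exact (mul_dvd_mul_iff_left (pow_ne_zero 2 hp.ne_zero)).1 this
    have h4 := hp.dvd_of_dvd_pow h3
    exact hp.not_isUnit (hk p (mul_dvd_mul_left p h4))
  · have h1 : IsCoprime (p ^ 3) (k ^ 2) := ((Prime.coprime_iff_not_dvd hp).2 hpk).pow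
    have h2 : p ^ 3 ∣ h := h1.dvd_of_dvd_mul_right hd
    exact hp.not_isUnit (hh p ((Dvd.intro_left p (by ring)).trans h2))

lemma pcf_int (m : ℤ) (hcf : ∀ p : ℤ, Prime p → ¬ (p ^ 3 ∣ m)) (q : ℚ) (n : ℤ)
    (hq : q ^ 3 * m = n) : ∃ z : ℤ, q = z := by
  have hd : (q.den : ℚ) ≠ 0 := by exact_mod_cast q.den_ne_zero
  have h1 : q.num ^ 3 * m = n * (q.den : ℤ) ^ 3 := by
    have : (q.num : ℚ) ^ 3 * m = n * (q.den : ℚ) ^ 3 := by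
      rw [← hq]
      nth_rewrite 2 [← Rat.num_div_den q]
      field_simp
    exact_mod_cast this
  have hco : IsCoprime ((q.den : ℤ) ^ 3) (q.num ^ 3) := by
    apply IsCoprime.pow
    rw [Int.isCoprime_iff_gcd_eq_one]
    have := q.reduced
    rw [Int.gcd_comm]
    simpa [Int.gcd, Nat.Coprime] using this
  have h2 : (q.den : ℤ) ^ 3 ∣ m := hco.dvd_of_dvd_mul_left ⟨n, by rw [h1]; ring⟩
  by_cases h3 : q.den = 1
  · exact ⟨q.num, (Rat.den_eq_one_iff q).1 h3 |>.symm⟩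
  · obtain ⟨p, hp, hpd⟩ := Nat.exists_prime_and_dvd h3
    exact absurd ((pow_dvd_pow_of_dvd (Int.natCast_dvd_natCast.2 hpd) 3).trans h2)
      (hcf p (Nat.prime_iff_prime_int.1 hp))

lemma pcf_rat (x : ℚ) (hx : IsIntegral ℤ x) : ∃ z : ℤ, x = z := by
  obtain ⟨z, hz⟩ := IsIntegrallyClosed.isIntegral_iff.1 hx
  exact ⟨z, by rw [← hz]; simp⟩

lemma pcf_quad (u : ℚ) (e f : ℤ) (h : u ^ 2 = e * u - f) : ∃ z : ℤ, u = z := by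
  apply pcf_rat
  refine ⟨Polynomial.X ^ 2 - Polynomial.C e * Polynomial.X + Polynomial.C f, ?_, ?_⟩
  · monicity!
  · simp only [Polynomial.eval₂_add, Polynomial.eval₂_sub, Polynomial.eval₂_mul,
      Polynomial.eval₂_pow, Polynomial.eval₂_X, Polynomial.eval₂_C, h]
    simp

lemma pcf_core (h k : ℤ) (hh : Squarefree h) (hk : Squarefree k) (hc : IsCoprime h k)
    (a b c : ℚ) (t n0 n1 : ℤ) (ht : 3 * a = t)
    (hn0 : a ^ 3 + b ^ 3 * (h * k ^ 2) + c ^ 3 * (h ^ 2 * k) - 3 * a * b * c * (h * k) = n0)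
    (hn1 : (a + 1) ^ 3 + b ^ 3 * (h * k ^ 2) + c ^ 3 * (h ^ 2 * k)
      - 3 * (a + 1) * b * c * (h * k) = n1) :
    ∃ A B C : ℤ, a = A / 3 ∧ b = B / 3 ∧ c = C / 3 ∧ 3 ∣ A ^ 2 - h * k * B * C ∧
      27 ∣ A ^ 3 + B ^ 3 * (h * k ^ 2) + C ^ 3 * (h ^ 2 * k) - 3 * A * B * C * (h * k) := by
  set s : ℤ := n1 - n0 - 1 - t with hs
  have hsq : (s : ℚ) = 3 * a ^ 2 - 3 * b * c * (h * k) := by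
    rw [hs]; push_cast; rw [← hn0, ← hn1, ← ht]; ring
  set w : ℤ := t ^ 2 - 3 * s with hw
  have hwq : (w : ℚ) = 9 * b * c * (h * k) := by
    rw [hw]; push_cast; rw [hsq, ← ht]; ring
  set e : ℤ := 27 * n0 - t ^ 3 + 3 * t * w with he
  have heq : (e : ℚ) = 27 * b ^ 3 * (h * k ^ 2) + 27 * c ^ 3 * (h ^ 2 * k) := by
    rw [he]; push_cast; rw [hwq, ← ht, ← hn0]; ring
  obtain ⟨u, hu⟩ := pcf_quad (27 * b ^ 3 * (h * k ^ 2)) e (w ^ 3) (by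
    push_cast; rw [hwq, heq]; ring)
  obtain ⟨v, hv⟩ := pcf_quad (27 * c ^ 3 * (h ^ 2 * k)) e (w ^ 3) (by
    push_cast; rw [hwq, heq]; ring)
  obtain ⟨B, hB⟩ := pcf_int (h * k ^ 2) (pcf_cubefree h k hh hk hc) (3 * b) u (by
    rw [← hu]; push_cast; ring)
  obtain ⟨C, hC⟩ := pcf_int (k * h ^ 2) (pcf_cubefree k h hk hh hc.symm) (3 * c) v (by
    rw [← hv]; push_cast; ring)
  have ha' : a = t / 3 := by linarith
  have hb' : b = B / 3 := by linarith
  have hc' : c = C / 3 := by linarith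
  refine ⟨t, B, C, ha', hb', hc', ⟨s, ?_⟩, ⟨n0, ?_⟩⟩
  · have : (t : ℚ) ^ 2 - h * k * B * C = 3 * s := by
      rw [hsq, ← ht, ← hB, ← hC]; ring
    exact_mod_cast this
  · have : (t : ℚ) ^ 3 + B ^ 3 * (h * k ^ 2) + C ^ 3 * (h ^ 2 * k) - 3 * t * B * C * (h * k)
      = 27 * n0 := by
      rw [← hn0, ← ht, ← hB, ← hC]; ring
    exact_mod_cast this

lemma pcf_discr (K : Type*) [Field K] [NumberField K] (b : Module.Basis (Fin 3) ℚ K)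
    (hb : ∀ i, IsIntegral ℤ (b i))
    (hr : ∀ x : K, IsIntegral ℤ x → ∀ i, ∃ z : ℤ, b.repr x i = z) :
    (NumberField.discr K : ℚ) = Algebra.discr ℚ b := by
  rw [NumberField.coe_discr]
  apply Algebra.discr_eq_discr_of_toMatrix_coeff_isIntegral
  · intro i j
    rw [Module.Basis.toMatrix_apply]
    have := NumberField.integralBasis_repr_apply K ⟨b j, hb j⟩ i
    erw [this]
    exact isIntegral_algebraMap
  · intro i j
    rw [Module.Basis.toMatrix_apply]
    obtain ⟨z, hz⟩ := hr (NumberField.integralBasis K j) (by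
      rw [NumberField.integralBasis_apply]; exact NumberField.RingOfIntegers.isIntegral_coe _) i
    rw [hz]
    exact isIntegral_algebraMap (R := ℤ) (x := z)

lemma pcf_indep (K : Type*) [Field K] [NumberField K] 
    (m : ℤ) (hcf : ∀ p : ℤ, Prime p → ¬(p ^ 3 ∣ m)) (hm1 : m ≠ 1) (hm1' : m ≠ -1)
    (α : K) (hα : α ^ 3 = (m : K)) (x y z : ℚ) (h : (x : K) + y * α + z * α ^ 2 = 0) :
    x = 0 ∧ y = 0 ∧ z = 0 := by
  have hirr : Irreducible (Polynomial.X ^ 3 - Polynomial.C (m : ℚ)) := by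
    apply X_pow_sub_C_irreducible_of_prime Nat.prime_three
    intro b hb
    obtain ⟨r, rfl⟩ := pcf_int 1 (by
      intro p hp hd
      exact hp.not_isUnit (isUnit_of_dvd_one ((Dvd.intro_left (p ^ 2) (by ring)).trans hd))) b m
      (by simpa using hb)
    have hb : r ^ 3 = m := by exact_mod_cast hb
    by_cases hu : IsUnit r
    · rcases Int.isUnit_iff.1 hu with rfl | rfl
      · exact hm1 (by rw [← hb]; norm_num)
      · exact hm1' (by rw [← hb]; norm_num)
    · by_cases hr0 : r = 0
      · exact hcf 2 Int.prime_two (by rw [← hb, hr0]; norm_num)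
      obtain ⟨p, hp, hpd⟩ := WfDvdMonoid.exists_irreducible_factor hu hr0
      exact hcf p hp.prime (by rw [← hb]; exact pow_dvd_pow_of_dvd hpd 3)
  have hmin : minpoly ℚ α = Polynomial.X ^ 3 - Polynomial.C (m : ℚ) := by
    symm
    apply minpoly.eq_of_irreducible_of_monic hirr
    · simp [hα]
    · monicity!
  have hli := linearIndependent_pow (K := ℚ) α
  have hd : (minpoly ℚ α).natDegree = 3 := by rw [hmin]; compute_degree!
  rw [hd, Fintype.linearIndependent_iff] at hli
  have := hli ![x, y, z] (by simp [Fin.sum_univ_three, Algebra.smul_def]; exact h)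
  exact ⟨this 0, this 1, this 2⟩
set_option synthInstance.maxHeartbeats 400000 in
set_option synthInstance.maxSize 2000 in
lemma pcf_dec3 : ∀ h k a b c : ZMod 3, h ≠ 0 → k ≠ 0 → a ^ 2 - h * k * b * c = 0 →
   a ^ 3 + b ^ 3 * (h * k ^ 2) + c ^ 3 * (h ^ 2 * k) - 3 * a * b * c * (h * k) = 0 →
   a - k * c = 0 ∧ b - h * k * c = 0 := by
  decide +kernel

lemma pcf_dec27 : ∀ h k : ZMod 27, (3 * (h * k ^ 2) = 3 → k * (k ^ 2 + k ^ 2 * (h * k ^ 2) + h ^ 2 - 3 * (h * k ^ 2)) = 0) ∧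
  (3 * (h * k ^ 2) = -3 → k * (k ^ 2 - k ^ 2 * (h * k ^ 2) + h ^ 2 + 3 * (h * k ^ 2)) = 0) := by
  decide +kernel

lemma pcf_dec27' : ∀ h k : ZMod 27, 9 * h ≠ 0 → 9 * k ≠ 0 →
   k ^ 3 + (h * k) ^ 3 * (h * k ^ 2) + h ^ 2 * k - 3 * k * (h * k) * (h * k) = 0 →
   3 * (h * k ^ 2) = 3 ∨ 3 * (h * k ^ 2) = -3 := by
  decide +kernel

lemma pcf_sq3 (h : ℤ) (hh : ¬ 3 ∣ h) : (3 : ℤ) ∣ h ^ 2 - 1 := by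
  have : h % 3 = 1 ∨ h % 3 = 2 := by omega
  rcases this with e | e
  · obtain ⟨x, rfl⟩ : ∃ x, h = 3 * x + 1 := ⟨h / 3, by omega⟩
    exact ⟨3 * x ^ 2 + 2 * x, by ring⟩
  · obtain ⟨x, rfl⟩ : ∃ x, h = 3 * x + 2 := ⟨h / 3, by omega⟩
    exact ⟨3 * x ^ 2 + 4 * x + 1, by ring⟩

/-- the mod 3 part -/
lemma pcf_mod3 (h k A B C : ℤ) (hh : ¬ 3 ∣ h) (hk : ¬ 3 ∣ k)
    (h1 : 3 ∣ A ^ 2 - h * k * B * C)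
    (h2 : 27 ∣ A ^ 3 + B ^ 3 * (h * k ^ 2) + C ^ 3 * (h ^ 2 * k) - 3 * A * B * C * (h * k)) :
    3 ∣ A - k * C ∧ 3 ∣ B - h * k * C := by
  have := pcf_dec3 h k A B C
  have h2' := (show (3 : ℤ) ∣ 27 by norm_num).trans h2
  have e (z : ℤ) : (z : ZMod 3) = 0 ↔ (3 : ℤ) ∣ z := by simpa using ZMod.intCast_zmod_eq_zero_iff_dvd z 3
  rw [← e] at h1 h2' hh hk
  rw [← e, ← e]
  push_cast at h1 h2' ⊢
  exact this hh hk h1 h2'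

lemma pcf_mod27 (h k A B C : ℤ) (hh : ¬ 3 ∣ h) (hk : ¬ 3 ∣ k)
    (h1 : 3 ∣ A ^ 2 - h * k * B * C)
    (h2 : 27 ∣ A ^ 3 + B ^ 3 * (h * k ^ 2) + C ^ 3 * (h ^ 2 * k) - 3 * A * B * C * (h * k)) :
    3 ∣ C ∨ 9 ∣ h * k ^ 2 - 1 ∨ 9 ∣ h * k ^ 2 + 1 := by
  obtain ⟨⟨a, ha⟩, ⟨b, hb⟩⟩ := pcf_mod3 h k A B C hh hk h1 h2
  by_cases hC : 3 ∣ C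
  · exact Or.inl hC
  right
  obtain rfl : A = k * C + 3 * a := by linarith
  obtain rfl : B = h * k * C + 3 * b := by linarith
  obtain ⟨i, hi⟩ := pcf_sq3 h hh
  obtain ⟨j, hj⟩ := pcf_sq3 k hk
  obtain ⟨n, hn⟩ := h2
  have key : (27 : ℤ) ∣ C ^ 3 * (k ^ 3 + (h * k) ^ 3 * (h * k ^ 2) + h ^ 2 * k - 3 * k * (h * k) * (h * k)) := by
    refine ⟨n - (a ^ 2 * k * C + a ^ 3 + h * k ^ 2 * (b ^ 2 * h * k * C + b ^ 3) - a * b * C * h * k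
      - i * a * C ^ 2 * k ^ 2 + b * C ^ 2 * h * k ^ 2 * (i + j + 3 * i * j)), ?_⟩
    linear_combination hn + 9 * a * C ^ 2 * k ^ 2 * hi
      - 9 * b * C ^ 2 * h * k ^ 2 * (k ^ 2 * hi + (1 + 3 * i) * hj)
  have hco : IsCoprime (27 : ℤ) (C ^ 3) := by
    rw [show (27 : ℤ) = 3 ^ 3 by norm_num]
    exact ((Prime.coprime_iff_not_dvd Int.prime_three).2 hC).pow
  have key2 := hco.dvd_of_dvd_mul_left key
  have e (z : ℤ) : (z : ZMod 27) = 0 ↔ (27 : ℤ) ∣ z := by simpa using ZMod.intCast_zmod_eq_zero_iff_dvd z 27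
  rw [← e] at key2
  have := pcf_dec27' h k (by
    intro h9
    have : ((9 * h : ℤ) : ZMod 27) = 0 := by push_cast; exact h9
    rw [e] at this; omega) (by
    intro h9
    have : ((9 * k : ℤ) : ZMod 27) = 0 := by push_cast; exact h9
    rw [e] at this; omega) (by push_cast at key2; exact key2)
  rcases this with h' | h'
  · left
    have : ((3 * (h * k ^ 2) - 3 : ℤ) : ZMod 27) = 0 := by push_cast; rw [h']; ring
    rw [e] at this; omega
  · right
    have : ((3 * (h * k ^ 2) + 3 : ℤ) : ZMod 27) = 0 := by push_cast; rw [h']; ring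
    rw [e] at this; omega

lemma pcf_three_h (h k A B C : ℤ) (hh : Squarefree h) (h3 : 3 ∣ h) (hk : ¬ 3 ∣ k)
    (h1 : 3 ∣ A ^ 2 - h * k * B * C)
    (h2 : 27 ∣ A ^ 3 + B ^ 3 * (h * k ^ 2) + C ^ 3 * (h ^ 2 * k) - 3 * A * B * C * (h * k)) :
    3 ∣ A ∧ 3 ∣ B ∧ 3 ∣ C := by
  have p3 := Int.prime_three
  obtain ⟨g, rfl⟩ := h3
  have hg : ¬ (3 : ℤ) ∣ g := fun hg => p3.not_isUnit (hh 3 (mul_dvd_mul_left 3 hg))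
  have hA : (3 : ℤ) ∣ A := by
    apply p3.dvd_of_dvd_pow (n := 2)
    have := dvd_add h1 (⟨g * k * B * C, rfl⟩ : (3 : ℤ) ∣ 3 * (g * k * B * C))
    convert this using 1; ring
  obtain ⟨a, rfl⟩ := hA
  obtain ⟨n, hn⟩ := h2
  have hB : (3 : ℤ) ∣ B := by
    have : (3 : ℤ) ∣ B ^ 3 * (g * k ^ 2) :=
      ⟨3 * n - 3 * a ^ 3 - C ^ 3 * g ^ 2 * k + 3 * a * B * C * (g * k), by linarith⟩
    rcases p3.dvd_mul.1 this with h | h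
    · exact p3.dvd_of_dvd_pow h
    · rcases p3.dvd_mul.1 h with h | h
      · exact absurd h hg
      · exact absurd (p3.dvd_of_dvd_pow h) hk
  obtain ⟨b, rfl⟩ := hB
  have hC : (3 : ℤ) ∣ C := by
    have : (3 : ℤ) ∣ C ^ 3 * (g ^ 2 * k) :=
      ⟨n - a ^ 3 - 3 * b ^ 3 * g * k ^ 2 + 3 * a * b * C * (g * k), by linarith⟩
    rcases p3.dvd_mul.1 this with h | h
    · exact p3.dvd_of_dvd_pow h
    · rcases p3.dvd_mul.1 h with h | h
      · exact absurd (p3.dvd_of_dvd_pow h) hg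
      · exact absurd h hk
  exact ⟨⟨a, rfl⟩, ⟨b, rfl⟩, hC⟩

lemma pcf_three_k (h k A B C : ℤ) (hk : Squarefree k) (h3 : 3 ∣ k) (hh : ¬ 3 ∣ h)
    (h1 : 3 ∣ A ^ 2 - h * k * B * C)
    (h2 : 27 ∣ A ^ 3 + B ^ 3 * (h * k ^ 2) + C ^ 3 * (h ^ 2 * k) - 3 * A * B * C * (h * k)) :
    3 ∣ A ∧ 3 ∣ B ∧ 3 ∣ C := by
  obtain ⟨a, b, c⟩ := pcf_three_h k h A C B hk h3 hh (by convert h1 using 1; ring)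
    (by convert h2 using 1; ring)
  exact ⟨a, c, b⟩

lemma pcf_not (h k A B C : ℤ) (hh : Squarefree h) (hk : Squarefree k) (hc : IsCoprime h k)
    (hm : ¬ 9 ∣ h * k ^ 2 - 1) (hm' : ¬ 9 ∣ h * k ^ 2 + 1)
    (h1 : 3 ∣ A ^ 2 - h * k * B * C)
    (h2 : 27 ∣ A ^ 3 + B ^ 3 * (h * k ^ 2) + C ^ 3 * (h ^ 2 * k) - 3 * A * B * C * (h * k)) :
    3 ∣ A ∧ 3 ∣ B ∧ 3 ∣ C := by
  by_cases h3 : 3 ∣ h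
  · exact pcf_three_h h k A B C hh h3
      (fun hk3 => Int.prime_three.not_isUnit (hc.isUnit_of_dvd' h3 hk3)) h1 h2
  by_cases k3 : 3 ∣ k
  · exact pcf_three_k h k A B C hk k3 h3 h1 h2
  have hC : 3 ∣ C := by
    rcases pcf_mod27 h k A B C h3 k3 h1 h2 with h | h | h
    · exact h
    · exact absurd h hm
    · exact absurd h hm'
  obtain ⟨hA, hB⟩ := pcf_mod3 h k A B C h3 k3 h1 h2
  refine ⟨?_, ?_, hC⟩
  · have := dvd_add hA (hC.mul_left k); simpa using this
  · have := dvd_add hB (hC.mul_left (h * k)); simpa using this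

lemma pcf_yes (h k A B C ε : ℤ) (hε : ε = 1 ∨ ε = -1) 
    (hm : 9 ∣ h * k ^ 2 - ε)
    (h1 : 3 ∣ A ^ 2 - h * k * B * C)
    (h2 : 27 ∣ A ^ 3 + B ^ 3 * (h * k ^ 2) + C ^ 3 * (h ^ 2 * k) - 3 * A * B * C * (h * k)) :
    3 ∣ A - k * C ∧ 3 ∣ B - ε * k * C := by
  have h3 : ¬ 3 ∣ h := by
    rintro ⟨g, rfl⟩
    rw [mul_assoc] at hm
    generalize g * k ^ 2 = t at hm
    omega
  have k3 : ¬ 3 ∣ k := by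
    rintro ⟨g, rfl⟩
    rw [show h * (3 * g) ^ 2 = 9 * (h * g ^ 2) by ring] at hm
    generalize h * g ^ 2 = t at hm
    omega
  obtain ⟨hA, hB⟩ := pcf_mod3 h k A B C h3 k3 h1 h2
  refine ⟨hA, ?_⟩
  obtain ⟨b, hb⟩ := hB
  obtain ⟨j, hj⟩ := pcf_sq3 k k3
  obtain ⟨n, hn⟩ := hm
  -- h = ε + 9n - 3hj
  exact ⟨b + (3 * n - h * j) * k * C, by linear_combination hb + k * C * hn - k * C * h * hj⟩

lemma pcf_gamma (h k ε : ℤ) (hε : ε = 1 ∨ ε = -1) (hm : 9 ∣ h * k ^ 2 - ε) :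
    (∃ s, 3 * s = k ^ 2 - ε * (h * k ^ 2)) ∧
    ∃ n, 27 * n = k ^ 3 + ε * k ^ 3 * (h * k ^ 2) + h ^ 2 * k - 3 * ε * k * (h * k ^ 2) := by
  have k3 : ¬ 3 ∣ k := by
    rintro ⟨g, rfl⟩
    rw [show h * (3 * g) ^ 2 = 9 * (h * g ^ 2) by ring] at hm
    generalize h * g ^ 2 = t at hm
    omega
  have hε2 : ε ^ 2 = 1 := by rcases hε with rfl | rfl <;> norm_num
  constructor
  · obtain ⟨j, hj⟩ := pcf_sq3 k k3
    obtain ⟨n, hn⟩ := hm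
    exact ⟨j - 3 * ε * n, by linear_combination -hj + ε * hn + hε2⟩
  · have e (z : ℤ) : (z : ZMod 27) = 0 ↔ (27 : ℤ) ∣ z := by
      simpa using ZMod.intCast_zmod_eq_zero_iff_dvd z 27
    obtain ⟨n, hn⟩ := hm
    have h3 : ((3 * (h * k ^ 2) - 3 * ε : ℤ) : ZMod 27) = 0 := by
      rw [e]; exact ⟨n, by linarith⟩
    suffices (27 : ℤ) ∣ k ^ 3 + ε * k ^ 3 * (h * k ^ 2) + h ^ 2 * k - 3 * ε * k * (h * k ^ 2) by
      obtain ⟨n, hn⟩ := this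
      exact ⟨n, hn.symm⟩
    rw [← e]
    push_cast at h3 ⊢
    rcases hε with rfl | rfl
    · have := (pcf_dec27 h k).1 (by push_cast at h3; linear_combination h3)
      push_cast
      linear_combination this
    · have := (pcf_dec27 h k).2 (by push_cast at h3; linear_combination h3)
      push_cast
      linear_combination this

lemma pcf_basis (K : Type*) [Field K] [NumberField K] (hdeg : Module.finrank ℚ K = 3)
    (x y z : K) (hli : ∀ a b c : ℚ, (a : K) * x + b * y + c * z = 0 → a = 0 ∧ b = 0 ∧ c = 0) :
    ∃ b : Module.Basis (Fin 3) ℚ K, b 0 = x ∧ b 1 = y ∧ b 2 = z := by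
  have h : LinearIndependent ℚ ![x, y, z] := by
    rw [Fintype.linearIndependent_iff]
    intro g hg
    obtain ⟨h0, h1, h2⟩ := hli (g 0) (g 1) (g 2) (by
      simpa [Fin.sum_univ_three, Algebra.smul_def] using hg)
    intro i
    fin_cases i <;> assumption
  refine ⟨basisOfLinearIndependentOfCardEqFinrank h (by simp [hdeg]), ?_, ?_, ?_⟩ <;> simp

lemma pcf_repr (K : Type*) [Field K] [NumberField K] (b : Module.Basis (Fin 3) ℚ K)
    (v : K) (p q r : ℚ) (hv : v = (p : K) * b 0 + q * b 1 + r * b 2) :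
    b.repr v 0 = p ∧ b.repr v 1 = q ∧ b.repr v 2 = r := by
  have : v = p • b 0 + q • b 1 + r • b 2 := by
    rw [hv]; simp [Algebra.smul_def]
  rw [this]
  simp

lemma pcf_mat (K : Type*) [Field K] [NumberField K] (h k : ℤ) (b : Module.Basis (Fin 3) ℚ K)
    (h0 : b 0 = 1) (h11 : b 1 * b 1 = k * b 2) (h12 : b 1 * b 2 = h * k)
    (h22 : b 2 * b 2 = h * b 1) (p q r : ℚ) :
    Algebra.leftMulMatrix b ((p : K) + q * b 1 + r * b 2) =
      !![p, r * (h * k), q * (h * k); q, p, r * h; r, q * k, p] := by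
  have c0 := pcf_repr K b (((p : K) + q * b 1 + r * b 2) * b 0) p q r (by rw [h0]; ring)
  have c1 := pcf_repr K b (((p : K) + q * b 1 + r * b 2) * b 1) (r * (h * k)) p (q * k) (by
    rw [h0]; push_cast; linear_combination (q : K) * h11 + r * h12)
  have c2 := pcf_repr K b (((p : K) + q * b 1 + r * b 2) * b 2) (q * (h * k)) (r * h) p (by
    rw [h0]; push_cast; linear_combination (q : K) * h12 + r * h22)
  ext i j
  rw [Algebra.leftMulMatrix_eq_repr_mul]
  fin_cases j <;> fin_cases i <;> simp [c0, c1, c2]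

lemma pcf_trace (K : Type*) [Field K] [NumberField K] (h k : ℤ) (b : Module.Basis (Fin 3) ℚ K)
    (h0 : b 0 = 1) (h11 : b 1 * b 1 = k * b 2) (h12 : b 1 * b 2 = h * k)
    (h22 : b 2 * b 2 = h * b 1) (p q r : ℚ) :
    Algebra.trace ℚ K ((p : K) + q * b 1 + r * b 2) = 3 * p := by
  rw [Algebra.trace_eq_matrix_trace b, pcf_mat K h k b h0 h11 h12 h22, Matrix.trace_fin_three]
  simp; ring

lemma pcf_norm (K : Type*) [Field K] [NumberField K] (h k : ℤ) (b : Module.Basis (Fin 3) ℚ K)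
    (h0 : b 0 = 1) (h11 : b 1 * b 1 = k * b 2) (h12 : b 1 * b 2 = h * k)
    (h22 : b 2 * b 2 = h * b 1) (p q r : ℚ) :
    Algebra.norm ℚ ((p : K) + q * b 1 + r * b 2) =
      p ^ 3 + q ^ 3 * (h * k ^ 2) + r ^ 3 * (h ^ 2 * k) - 3 * p * q * r * (h * k) := by
  rw [Algebra.norm_eq_matrix_det b, pcf_mat K h k b h0 h11 h12 h22, Matrix.det_fin_three]
  simp; ring

lemma pcf_disc (K : Type*) [Field K] [NumberField K] (h k : ℤ) (b : Module.Basis (Fin 3) ℚ K)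
    (h0 : b 0 = 1) (h11 : b 1 * b 1 = k * b 2) (h12 : b 1 * b 2 = h * k)
    (h22 : b 2 * b 2 = h * b 1) :
    Algebra.discr ℚ b = -27 * (h * k) ^ 2 := by
  have T := pcf_trace K h k b h0 h11 h12 h22
  have t00 : Algebra.trace ℚ K (b 0 * b 0) = 3 := by
    have := T 1 0 0; rw [h0]; simpa using this
  have t01 : Algebra.trace ℚ K (b 0 * b 1) = 0 := by
    have := T 0 1 0; rw [h0]; simpa using this
  have t02 : Algebra.trace ℚ K (b 0 * b 2) = 0 := by
    have := T 0 0 1; rw [h0]; simpa using this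
  have t11 : Algebra.trace ℚ K (b 1 * b 1) = 0 := by
    have := T 0 0 k; rw [h11]; simpa using this
  have t12 : Algebra.trace ℚ K (b 1 * b 2) = 3 * (h * k) := by
    have := T (h * k) 0 0; rw [h12]; simpa using this
  have t22 : Algebra.trace ℚ K (b 2 * b 2) = 0 := by
    have := T 0 h 0; rw [h22]; simpa using this
  rw [Algebra.discr_def, Matrix.det_fin_three]
  simp only [Algebra.traceMatrix_apply, Algebra.traceForm_apply, mul_comm (b 1) (b 0),
    mul_comm (b 2) (b 0), mul_comm (b 2) (b 1), t00, t01, t02, t11, t12, t22]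
  ring

lemma pcf_expand (K : Type*) [Field K] [NumberField K] (b : Module.Basis (Fin 3) ℚ K)
    (h0 : b 0 = 1) (x : K) :
    x = (b.repr x 0 : K) + b.repr x 1 * b 1 + b.repr x 2 * b 2 := by
  conv_lhs => rw [← b.sum_repr x]
  simp [Fin.sum_univ_three, Algebra.smul_def, h0]

lemma pcf_integral (K : Type*) [Field K] [NumberField K] (h k : ℤ)
    (hh : Squarefree h) (hk : Squarefree k) (hc : IsCoprime h k) (b : Module.Basis (Fin 3) ℚ K)
    (h0 : b 0 = 1) (h11 : b 1 * b 1 = k * b 2) (h12 : b 1 * b 2 = h * k)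
    (h22 : b 2 * b 2 = h * b 1) (x : K) (hx : IsIntegral ℤ x) :
    ∃ A B C : ℤ, b.repr x 0 = A / 3 ∧ b.repr x 1 = B / 3 ∧ b.repr x 2 = C / 3 ∧
      3 ∣ A ^ 2 - h * k * B * C ∧
      27 ∣ A ^ 3 + B ^ 3 * (h * k ^ 2) + C ^ 3 * (h ^ 2 * k) - 3 * A * B * C * (h * k) := by
  have hX := pcf_expand K b h0 x
  obtain ⟨t, ht⟩ := pcf_rat _ (Algebra.isIntegral_trace (L := ℚ) hx)
  obtain ⟨n0, hn0⟩ := pcf_rat _ (Algebra.isIntegral_norm ℚ hx)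
  obtain ⟨n1, hn1⟩ := pcf_rat _ (Algebra.isIntegral_norm ℚ (hx.add isIntegral_one))
  apply pcf_core h k hh hk hc _ _ _ t n0 n1
  · rw [← ht, ← pcf_trace K h k b h0 h11 h12 h22 _ (b.repr x 1) (b.repr x 2), ← hX]
  · rw [← hn0, ← pcf_norm K h k b h0 h11 h12 h22, ← hX]
  · rw [← hn1, ← pcf_norm K h k b h0 h11 h12 h22]
    congr 1
    conv_rhs => rw [hX]
    push_cast; ring

lemma pcf_case2 (K : Type*) [Field K] [NumberField K] (hdeg : Module.finrank ℚ K = 3) (h k ε : ℤ)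
    (hh : Squarefree h) (hk : Squarefree k) (hc : IsCoprime h k) (b : Module.Basis (Fin 3) ℚ K)
    (h0 : b 0 = 1) (h11 : b 1 * b 1 = k * b 2) (h12 : b 1 * b 2 = h * k)
    (h22 : b 2 * b 2 = h * b 1) (hi : IsIntegral ℤ (b 1)) 
    (hε : ε = 1 ∨ ε = -1) (hm : 9 ∣ h * k ^ 2 - ε) :
    (NumberField.discr K : ℚ) = -3 * (h * k) ^ 2 := by
  obtain ⟨⟨s, hs⟩, ⟨n, hn⟩⟩ := pcf_gamma h k ε hε hm
  have hε2 : ε ^ 2 = 1 := by rcases hε with rfl | rfl <;> norm_num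
  set γ : K := (k + ε * k * b 1 + b 2) / 3 with hγ
  have hγi : IsIntegral ℤ γ := by
    refine ⟨Polynomial.X ^ 3 - Polynomial.C k * Polynomial.X ^ 2 + Polynomial.C s * Polynomial.X
      - Polynomial.C n, by monicity!, ?_⟩
    simp only [Polynomial.eval₂_add, Polynomial.eval₂_sub, Polynomial.eval₂_mul,
      Polynomial.eval₂_pow, Polynomial.eval₂_X, Polynomial.eval₂_C]
    simp only [algebraMap_int_eq, eq_intCast]
    have hs' : (s : K) = (k ^ 2 - ε * (h * k ^ 2)) / 3 := by
      rw [eq_div_iff (by norm_num)]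
      have : ((3 * s : ℤ) : K) = ((k ^ 2 - ε * (h * k ^ 2) : ℤ) : K) := by rw [hs]
      push_cast at this; rw [← this]; ring
    have hn' : (n : K) = (k ^ 3 + ε * k ^ 3 * (h * k ^ 2) + h ^ 2 * k
        - 3 * ε * k * (h * k ^ 2)) / 27 := by
      rw [eq_div_iff (by norm_num)]
      have : ((27 * n : ℤ) : K) = ((k ^ 3 + ε * k ^ 3 * (h * k ^ 2) + h ^ 2 * k
        - 3 * ε * k * (h * k ^ 2) : ℤ) : K) := by rw [hn]
      push_cast at this; rw [← this]; ring
    have hε2' : (ε : K) ^ 2 = 1 := by exact_mod_cast hε2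
    rw [hs', hn', hγ]
    have h2 : (3 : K) ≠ 0 := by norm_num
    generalize (b 1) = α at *
    generalize (b 2) = β at *
    generalize (h : K) = H at *
    generalize (k : K) = k' at *
    generalize (ε : K) = e at *
    clear hn' hs'
    grind
  obtain ⟨b', b0, b1, b2⟩ := pcf_basis K hdeg 1 (b 1) γ (by
    intro x y z hz
    have := pcf_repr K b 0 (x + z * k / 3) (y + z * (ε * k) / 3) (z / 3) (by
      rw [h0, ← hz, hγ]; push_cast; ring)
    simp only [map_zero, Finsupp.coe_zero, Pi.zero_apply] at this
    obtain ⟨e0, e1, e2⟩ := this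
    obtain rfl : z = 0 := by linarith
    refine ⟨by linarith, by linarith, rfl⟩)
  have hd : Algebra.discr ℚ b' = (1 / 3) ^ 2 * Algebra.discr ℚ b := by
    have := Algebra.discr_of_matrix_vecMul b
      (!![1, 0, (k : ℚ) / 3; 0, 1, ε * k / 3; 0, 0, 1 / 3])
    rw [Matrix.det_fin_three] at this
    have e : (b' : Fin 3 → K) = Matrix.vecMul (b : Fin 3 → K) 
      ((!![1, 0, (k : ℚ) / 3; 0, 1, ε * k / 3; 0, 0, 1 / 3]).map (algebraMap ℚ K)) := by
      ext i
      fin_cases i <;> simp [Matrix.vecMul, dotProduct, Fin.sum_univ_three, b0, b1, b2, h0, hγ]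
      ring
    rw [e, this]
    simp
  rw [pcf_discr K b', hd, pcf_disc K h k b h0 h11 h12 h22]
  · ring
  · intro i
    fin_cases i
    · simpa [b0] using isIntegral_one
    · simpa [b1] using hi
    · simpa [b2] using hγi
  · intro x hx i
    obtain ⟨A, B, C, hA, hB, hC, d1, d2⟩ :=
      pcf_integral K h k hh hk hc b h0 h11 h12 h22 x hx
    obtain ⟨⟨u, hu⟩, ⟨v, hv⟩⟩ := pcf_yes h k A B C ε hε hm d1 d2
    obtain rfl : A = k * C + 3 * u := by linarith
    obtain rfl : B = ε * k * C + 3 * v := by linarith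
    have hX := pcf_expand K b h0 x
    rw [hA, hB, hC] at hX
    have := pcf_repr K b' x u v C (by
      rw [hX, b0, b1, b2, hγ]; push_cast; ring)
    fin_cases i
    · exact ⟨u, this.1⟩
    · exact ⟨v, this.2.1⟩
    · exact ⟨C, this.2.2⟩

/-- Let `m = hk²` be a cube-free integer, `m ≠ 0, ±1`, with `h, k` coprime
squarefree integers, and let `K = ℚ(∛m)` be the corresponding pure cubic field.
If `m ≡ ±1 (mod 9)` the discriminant of `K` is `−3(hk)²`; otherwise it is
`−27(hk)²`. -/
theorem discr_pure_cubic_field (K : Type*) [Field K] [NumberField K]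
    (hdeg : Module.finrank ℚ K = 3)
    (m h k : ℤ) (hm : m = h * k ^ 2) (hh : Squarefree h) (hk : Squarefree k)
    (hcop : IsCoprime h k)
    (hcubefree : ∀ p : ℤ, Prime p → ¬(p ^ 3 ∣ m))
    (hm0 : m ≠ 0) (hm1 : m ≠ 1) (hm1' : m ≠ -1)
    (α : K) (hα : α ^ 3 = (m : K)) :
    NumberField.discr K =
      if ((m : ZMod 9) = 1 ∨ (m : ZMod 9) = -1) then -3 * (h * k) ^ 2
      else -27 * (h * k) ^ 2 := by
  have hk0 : (k : K) ≠ 0 := by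
    have : k ≠ 0 := by rintro rfl; simp at hm; exact hm0 hm
    exact_mod_cast this
  have hkq : (k : ℚ) ≠ 0 := by exact_mod_cast hk0
  have hα' : α ^ 3 = h * k ^ 2 := by rw [hα, hm]; push_cast; rfl
  obtain ⟨b, h0, hb1, hb2⟩ := pcf_basis K hdeg 1 α (α ^ 2 / k) (by
    intro x y z hz
    obtain ⟨e0, e1, e2⟩ := pcf_indep K m hcubefree hm1 hm1' α hα x y (z / k) (by
      rw [← hz]; push_cast; field_simp)
    refine ⟨e0, e1, ?_⟩
    simpa [hkq] using e2)
  have h11 : b 1 * b 1 = k * b 2 := by rw [hb1, hb2]; field_simp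
  have h12 : b 1 * b 2 = h * k := by
    rw [hb1, hb2]; field_simp; linear_combination hα'
  have h22 : b 2 * b 2 = h * b 1 := by
    rw [hb1, hb2]; field_simp; linear_combination α * hα'
  have hi1 : IsIntegral ℤ (b 1) := by
    rw [hb1]
    apply IsIntegral.of_pow (n := 3) (by norm_num)
    rw [hα]; exact isIntegral_algebraMap (R := ℤ) (x := m)
  have hi2 : IsIntegral ℤ (b 2) := by
    apply IsIntegral.of_pow (n := 2) (by norm_num)
    rw [pow_two, h22]; exact (isIntegral_algebraMap (R := ℤ) (x := h)).mul hi1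
  have e (z : ℤ) : (z : ZMod 9) = 0 ↔ (9 : ℤ) ∣ z := by
    simpa using ZMod.intCast_zmod_eq_zero_iff_dvd z 9
  have e1 : (m : ZMod 9) = 1 ↔ 9 ∣ h * k ^ 2 - 1 := by
    rw [← e, ← hm]; push_cast; rw [sub_eq_zero]
  have e2 : (m : ZMod 9) = -1 ↔ 9 ∣ h * k ^ 2 + 1 := by
    rw [← e, ← hm]; push_cast; rw [eq_neg_iff_add_eq_zero]
  split_ifs with hc <;> rw [e1, e2] at hc
  · have : (NumberField.discr K : ℚ) = -3 * (h * k) ^ 2 := by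
      rcases hc with hc | hc
      · exact pcf_case2 K hdeg h k 1 hh hk hcop b h0 h11 h12 h22 hi1 (Or.inl rfl) hc
      · exact pcf_case2 K hdeg h k (-1) hh hk hcop b h0 h11 h12 h22 hi1 (Or.inr rfl) (by simpa using hc)
    exact_mod_cast this
  · push Not at hc
    have : (NumberField.discr K : ℚ) = -27 * (h * k) ^ 2 := by
      rw [pcf_discr K b, pcf_disc K h k b h0 h11 h12 h22]
      · intro i
        fin_cases i
        · simpa [h0] using isIntegral_one
        · exact hi1
        · exact hi2
      · intro x hx i
        obtain ⟨A, B, C, hA, hB, hC, d1, d2⟩ :=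
          pcf_integral K h k hh hk hcop b h0 h11 h12 h22 x hx
        obtain ⟨⟨u, rfl⟩, ⟨v, rfl⟩, ⟨w, rfl⟩⟩ := pcf_not h k A B C hh hk hcop hc.1 hc.2 d1 d2
        fin_cases i
        · exact ⟨u, by simp [hA]⟩
        · exact ⟨v, by simp [hB]⟩
        · exact ⟨w, by simp [hC]⟩
    exact_mod_cast this
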